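/- arXiv:2603.23099 — 3 statements merged into one kernel-verified Lean document; each statement's English description precedes it below -/
import Mathlib

section
/- Let m be a natural number, M a real number, and g, μ : Fin m → ℝ satisfy, for every i, g i ≤ 0, 0 ≤ μ i, −g i ≤ M and μ i ≤ M. Then (∀ i, μ i · g i = 0) if and only if there exists α : Fin m → ℝ such that for every i, (α i = 0 or α i = 1), −g i ≤ M·(1 − α i) and μ i ≤ M·(α i). -/
/-- Scalar Big-M linearization of a complementarity condition. -/
theorem bigM_complementarity {M g μ : ℝ} (hg : g ≤ 0) (hμ : 0 ≤ μ) (hgM : -g ≤ M) (hμM : μ ≤ M) :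
    μ * g = 0 ↔ ∃ a : ℝ, (a = 0 ∨ a = 1) ∧ -g ≤ M * (1 - a) ∧ μ ≤ M * a := by
  constructor
  · intro h
    rcases mul_eq_zero.mp h with h | h
    · exact ⟨0, Or.inl rfl, by linarith, by linarith⟩
    · exact ⟨1, Or.inr rfl, by linarith, by linarith⟩
  · rintro ⟨a, rfl | rfl, hga, hμa⟩
    · exact mul_eq_zero_of_left (by linarith) g
    · exact mul_eq_zero_of_right μ (by linarith)

/-- Vector form of the Fortuny–Amat (Big-M) linearization of a system of KKT
complementarity conditions. -/
theorem bigM_complementarity_system (m : ℕ) (M : ℝ) (g μ : Fin m → ℝ)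
    (hg : ∀ i, g i ≤ 0) (hμ : ∀ i, 0 ≤ μ i)
    (hgM : ∀ i, -g i ≤ M) (hμM : ∀ i, μ i ≤ M) :
    (∀ i, μ i * g i = 0) ↔
      ∃ α : Fin m → ℝ, ∀ i,
        (α i = 0 ∨ α i = 1) ∧ -g i ≤ M * (1 - α i) ∧ μ i ≤ M * α i := by
  rw [← Classical.skolem (p := fun i a => (a = 0 ∨ a = 1) ∧ -g i ≤ M * (1 - a) ∧ μ i ≤ M * a)]
  exact forall_congr' fun i => bigM_complementarity (hg i) (hμ i) (hgM i) (hμM i)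
end

section
/- Let n, m be natural numbers, f : EuclideanSpace ℝ (Fin n) → ℝ a convex function with gradient ∇f at every point, A an m×n real matrix and b ∈ ℝᵐ. If x* satisfies A x* ≤ b componentwise and f(x*) ≤ f(x) for every x with A x ≤ b componentwise, then there exists μ ∈ ℝᵐ with μ ≥ 0 componentwise, ∇f(x*) + Aᵀ μ = 0, and μ i · ((A x*) i − b i) = 0 for every i. -/
open Finset in
/-- **Farkas' lemma** for finitely many linear functionals on a vector space over an ordered
field. -/
theorem Module.Dual.exists_nonneg_eq_sum_of_forall_le_zero {𝕜 V ι : Type*} [Field 𝕜]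
    [LinearOrder 𝕜] [IsStrictOrderedRing 𝕜] [AddCommGroup V] [Module 𝕜 V] (s : Finset ι)
    (a : ι → Module.Dual 𝕜 V) (c : Module.Dual 𝕜 V)
    (h : ∀ x, (∀ i ∈ s, a i x ≤ 0) → c x ≤ 0) :
    ∃ μ : ι → 𝕜, (∀ i, 0 ≤ μ i) ∧ c = ∑ i ∈ s, μ i • a i := by
  classical
  induction s using Finset.induction_on generalizing a c with
  | empty =>
    refine ⟨0, fun _ => le_rfl, LinearMap.ext fun x => ?_⟩
    have h₁ := h x (by simp)
    have h₂ := h (-x) (by simp)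
    rw [map_neg] at h₂
    simpa using le_antisymm h₁ (by linarith)
  | insert j s hj ih =>
    have sum_update (μ : ι → 𝕜) (r : 𝕜) :
        ∑ i ∈ insert j s, Function.update μ j r i • a i = r • a j + ∑ i ∈ s, μ i • a i := by
      rw [sum_insert hj, Function.update_self]
      congr 1
      refine sum_congr rfl fun i hi => ?_
      rw [Function.update_of_ne (ne_of_mem_of_not_mem hi hj)]
    have update_nonneg {μ : ι → 𝕜} {r : 𝕜} (hμ : ∀ i, 0 ≤ μ i) (hr : 0 ≤ r) (i : ι) :
        0 ≤ Function.update μ j r i := by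
      rw [Function.update_apply]
      split_ifs
      exacts [hr, hμ i]
    by_cases hs : ∀ x, (∀ i ∈ s, a i x ≤ 0) → c x ≤ 0
    · obtain ⟨μ, hμ, rfl⟩ := ih a c hs
      exact ⟨Function.update μ j 0, update_nonneg hμ le_rfl, by rw [sum_update]; simp⟩
    · push Not at hs
      obtain ⟨z, hz, hcz⟩ := hs
      have haz : 0 < a j z := by
        by_contra! hle
        exact hcz.not_ge (h z (forall_mem_insert _ _ _ |>.2 ⟨hle, hz⟩))
      -- Project along `z` onto the kernel of `a j`.
      obtain ⟨μ, hμ, hc⟩ := ih (fun i => a i - (a i z / a j z) • a j)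
        (c - (c z / a j z) • a j) fun x hx => by
          have hy := h (x - (a j x / a j z) • z) <| forall_mem_insert _ _ _ |>.2
            ⟨by simp [haz.ne'], fun i hi => by
              have := hx i hi
              simp only [LinearMap.sub_apply, LinearMap.smul_apply, smul_eq_mul, map_sub,
                map_smul] at this ⊢
              convert this using 1
              ring⟩
          simp only [LinearMap.sub_apply, LinearMap.smul_apply, smul_eq_mul, map_sub,
            map_smul] at hy ⊢
          convert hy using 1
          ring
      refine ⟨Function.update μ j (c z / a j z + ∑ i ∈ s, μ i * (-a i z / a j z)),
        update_nonneg hμ (add_nonneg (div_nonneg hcz.le haz.le) (sum_nonneg fun i hi =>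
          mul_nonneg (hμ i) (div_nonneg (neg_nonneg.2 (hz i hi)) haz.le))), ?_⟩
      rw [sum_update, add_smul, sum_smul, add_assoc, ← sum_add_distrib, ← sub_eq_iff_eq_add', hc]
      refine sum_congr rfl fun i _ => ?_
      module

/-- A direction along which no active constraint of a finite system `a i x ≤ b i` increases is
tangent to the feasible set. -/
theorem mem_posTangentConeAt_setOf_forall_le {E ι : Type*} [NormedAddCommGroup E]
    [NormedSpace ℝ E] [Finite ι] {a : ι → E →ₗ[ℝ] ℝ} {b : ι → ℝ} {x d : E}
    (hx : ∀ i, a i x ≤ b i) (hd : ∀ i, a i x = b i → a i d ≤ 0) :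
    d ∈ posTangentConeAt {y | ∀ i, a i y ≤ b i} x := by
  refine mem_posTangentConeAt_of_frequently_mem (Filter.Eventually.frequently ?_)
  refine Filter.eventually_all.2 fun i => ?_
  simp only [map_add, map_smul, smul_eq_mul]
  rcases (hx i).lt_or_eq with hlt | heq
  · have hc : Filter.Tendsto (fun t : ℝ => a i x + t * a i d) (nhds 0) (nhds (a i x)) := by
      have : Continuous fun t : ℝ => a i x + t * a i d := by fun_prop
      simpa using this.tendsto 0
    filter_upwards [nhdsWithin_le_nhds (hc.eventually_lt_const hlt)] with t ht using ht.le
  · filter_upwards [self_mem_nhdsWithin] with t ht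
    have := mul_nonpos_of_nonneg_of_nonpos (Set.mem_Ioi.1 ht).le (hd i heq)
    linarith

/-- Necessity of the KKT conditions for a linearly constrained convex program:
at any global minimizer, KKT multipliers exist (no constraint qualification is
needed for affine constraints). -/
theorem kkt_necessary (n m : ℕ) (f : EuclideanSpace ℝ (Fin n) → ℝ)
    (f' : EuclideanSpace ℝ (Fin n) → EuclideanSpace ℝ (Fin n))
    (hconv : ConvexOn ℝ Set.univ f)
    (hgrad : ∀ x, HasGradientAt f (f' x) x)
    (A : Matrix (Fin m) (Fin n) ℝ) (b : Fin m → ℝ)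
    (xstar : EuclideanSpace ℝ (Fin n))
    (hprimal : ∀ i, A.mulVec xstar i ≤ b i)
    (hmin : ∀ x : EuclideanSpace ℝ (Fin n), (∀ i, A.mulVec x i ≤ b i) → f xstar ≤ f x) :
    ∃ μ : Fin m → ℝ, (∀ i, 0 ≤ μ i) ∧
      (∀ j, f' xstar j + A.transpose.mulVec μ j = 0) ∧
      (∀ i, μ i * (A.mulVec xstar i - b i) = 0) := by
  let a (i : Fin m) : Module.Dual ℝ (EuclideanSpace ℝ (Fin n)) :=
    LinearMap.proj i ∘ₗ A.mulVecLin ∘ₗ (WithLp.linearEquiv 2 ℝ (Fin n → ℝ)).toLinearMap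
  let s : Finset (Fin m) := {i | A.mulVec xstar i = b i}
  have hlocal : IsLocalMinOn f {y | ∀ i, a i y ≤ b i} xstar :=
    IsMinOn.localize fun x hx => hmin x hx
  obtain ⟨μ, hμ, hsum⟩ := Module.Dual.exists_nonneg_eq_sum_of_forall_le_zero s a
    (-(innerₗ _ (f' xstar))) fun d hd => by
      have := hlocal.hasFDerivWithinAt_nonneg (hgrad xstar).hasFDerivAt.hasFDerivWithinAt
        (mem_posTangentConeAt_setOf_forall_le hprimal fun i hi => hd i (by simpa [s] using! hi))
      simpa using this
  refine ⟨fun i => if i ∈ s then μ i else 0, fun i => ?_, fun j => ?_, fun i => ?_⟩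
  · dsimp only
    split_ifs
    exacts [hμ i, le_rfl]
  · have := LinearMap.congr_fun hsum (EuclideanSpace.single j 1)
    have hj : -f' xstar j = ∑ i ∈ s, A i j * μ i := by
      simpa [a, EuclideanSpace.inner_single_right, mul_comm] using this
    rw [← neg_eq_iff_add_eq_zero, hj]
    simp [Matrix.mulVec, dotProduct]
  · by_cases hi : A.mulVec xstar i = b i <;> simp [s, hi]
end

section
/- Let n, m be natural numbers, f : EuclideanSpace ℝ (Fin n) → ℝ a convex function with gradient ∇f at every point, A an m×n real matrix and b ∈ ℝᵐ. A point x* with A x* ≤ b componentwise is a global minimizer of f over {x : A x ≤ b componentwise} if and only if there exists μ ∈ ℝᵐ with μ ≥ 0 componentwise, ∇f(x*) + Aᵀ μ = 0, and μ i · ((A x*) i − b i) = 0 for every i. -/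
/-- **Farkas' lemma**, algebraic form for finitely many linear functionals. -/
theorem LinearMap.exists_nonneg_eq_sum_smul_of_forall_nonpos {𝕜 V ι : Type*} [Field 𝕜]
    [LinearOrder 𝕜] [IsStrictOrderedRing 𝕜] [AddCommGroup V] [Module 𝕜 V]
    (s : Finset ι) (a : ι → V →ₗ[𝕜] 𝕜) (c : V →ₗ[𝕜] 𝕜)
    (h : ∀ x, (∀ i ∈ s, a i x ≤ 0) → c x ≤ 0) :
    ∃ w : ι → 𝕜, (∀ i, 0 ≤ w i) ∧ c = ∑ i ∈ s, w i • a i := by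
  classical
  induction s using Finset.induction_on generalizing a c with
  | empty =>
    refine ⟨0, fun _ => le_rfl, LinearMap.ext fun x => ?_⟩
    have h₁ := h x (by simp)
    have h₂ := h (-x) (by simp)
    rw [map_neg] at h₂
    simpa using le_antisymm h₁ (by linarith)
  | insert k s hk ih =>
    by_cases hs : ∀ x, (∀ i ∈ s, a i x ≤ 0) → c x ≤ 0
    · obtain ⟨w, hw, hc⟩ := ih a c hs
      refine ⟨Function.update w k 0, fun i => ?_, ?_⟩
      · by_cases hi : i = k
        · simp [hi]
        · simpa [hi] using hw i
      · rw [Finset.sum_insert hk, Function.update_self, zero_smul, zero_add, hc]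
        refine Finset.sum_congr rfl fun i hi => ?_
        rw [Function.update_of_ne (ne_of_mem_of_not_mem hi hk)]
    · push Not at hs
      obtain ⟨y, hy, hcy⟩ := hs
      have hky : 0 < a k y := by
        by_contra! hky
        exact hcy.not_ge (h y (Finset.forall_mem_insert _ _ _ |>.2 ⟨hky, hy⟩))
      obtain ⟨w, hw, hc⟩ := ih (fun i => a i - (a i y / a k y) • a k)
        (c - (c y / a k y) • a k) (fun x hx => by
          have hproj : ∀ l : V →ₗ[𝕜] 𝕜,
              l (x - (a k x / a k y) • y) = (l - (l y / a k y) • a k) x := by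
            intro l
            simp only [map_sub, map_smul, smul_eq_mul, LinearMap.sub_apply, LinearMap.smul_apply]
            ring
          rw [← hproj]
          refine h _ (Finset.forall_mem_insert _ _ _ |>.2 ⟨?_, fun i hi => ?_⟩)
          · rw [hproj, div_self hky.ne']
            simp
          · rw [hproj]
            exact hx i hi)
      have hsum : ∑ i ∈ s, w i * (a i y / a k y) ≤ 0 :=
        Finset.sum_nonpos fun i hi => mul_nonpos_of_nonneg_of_nonpos (hw i)
          (div_nonpos_of_nonpos_of_nonneg (hy i hi) hky.le)
      have hcoef : 0 ≤ c y / a k y - ∑ i ∈ s, w i * (a i y / a k y) := by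
        have := div_pos hcy hky
        linarith
      refine ⟨Function.update w k (c y / a k y - ∑ i ∈ s, w i * (a i y / a k y)),
        fun i => ?_, ?_⟩
      · by_cases hi : i = k
        · simpa [hi] using hcoef
        · simpa [hi] using hw i
      · have hcongr : ∑ i ∈ s, Function.update w k
            (c y / a k y - ∑ i ∈ s, w i * (a i y / a k y)) i • a i = ∑ i ∈ s, w i • a i :=
          Finset.sum_congr rfl fun i hi => by
            rw [Function.update_of_ne (ne_of_mem_of_not_mem hi hk)]
        rw [Finset.sum_insert hk, Function.update_self, hcongr]
        refine (sub_eq_iff_eq_add.1 hc).trans ?_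
        simp only [smul_sub, Finset.sum_sub_distrib, smul_smul, ← Finset.sum_smul]
        module

/-- A convex function lies above its tangent hyperplanes. -/
theorem ConvexOn.add_fderiv_le {E : Type*} [NormedAddCommGroup E] [NormedSpace ℝ E]
    {f : E → ℝ} {f' : E →L[ℝ] ℝ} {s : Set E} {x y : E} (hf : ConvexOn ℝ s f)
    (hx : x ∈ s) (hy : y ∈ s) (hf' : HasFDerivAt f f' x) : f x + f' (y - x) ≤ f y := by
  have hderiv : HasDerivAt (f ∘ AffineMap.lineMap (k := ℝ) x y) (f' (y - x)) 0 :=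
    HasFDerivAt.comp_hasDerivAt 0 (by simpa using hf') AffineMap.hasDerivAt_lineMap
  have hslope := (hf.comp_affineMap (AffineMap.lineMap (k := ℝ) x y)).le_slope_of_hasDerivAt
    (x := 0) (y := 1) (by simpa using hx) (by simpa using hy) one_pos hderiv
  simp only [slope_def_field, Function.comp_apply, AffineMap.lineMap_apply_zero,
    AffineMap.lineMap_apply_one, sub_zero, div_one] at hslope
  linarith

open Filter Topology in
/-- At a feasible point of `A x ≤ b`, every direction along which the active constraints do not
increase is tangent to the feasible set. -/
theorem Matrix.mem_posTangentConeAt_of_active {m n : ℕ} (A : Matrix (Fin m) (Fin n) ℝ)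
    (b : Fin m → ℝ) {x d : EuclideanSpace ℝ (Fin n)} (hx : ∀ i, A.mulVec x i ≤ b i)
    (hd : ∀ i, A.mulVec x i = b i → A.mulVec d i ≤ 0) :
    d ∈ posTangentConeAt {y : EuclideanSpace ℝ (Fin n) | ∀ i, A.mulVec y i ≤ b i} x := by
  refine mem_posTangentConeAt_of_frequently_mem (Eventually.frequently ?_)
  simp only [Set.mem_ofPred_eq, eventually_all]
  intro i
  have heq : ∀ t : ℝ, A.mulVec (x + t • d : EuclideanSpace ℝ (Fin n)).ofLp i = A.mulVec x i + t * A.mulVec d i := by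
    simp [Matrix.mulVec_add, Matrix.mulVec_smul]
  rcases (hx i).eq_or_lt with hi | hi
  · filter_upwards [self_mem_nhdsWithin] with t ht
    rw [heq]
    linarith [mul_nonpos_of_nonneg_of_nonpos (le_of_lt ht) (hd i hi)]
  · have hlim : Tendsto (fun t : ℝ => A.mulVec x i + t * A.mulVec d i) (𝓝 0)
        (𝓝 (A.mulVec x i + 0 * A.mulVec d i)) := Continuous.tendsto (by fun_prop) 0
    filter_upwards [nhdsWithin_le_nhds (hlim.eventually_lt_const (by simpa using hi))] with t ht
    rw [heq]
    exact ht.le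


/-- KKT characterization of global minimizers of a linearly constrained convex
program: a feasible point is a global minimizer iff KKT multipliers exist. -/
theorem kkt_characterization (n m : ℕ) (f : EuclideanSpace ℝ (Fin n) → ℝ)
    (f' : EuclideanSpace ℝ (Fin n) → EuclideanSpace ℝ (Fin n))
    (hconv : ConvexOn ℝ Set.univ f)
    (hgrad : ∀ x, HasGradientAt f (f' x) x)
    (A : Matrix (Fin m) (Fin n) ℝ) (b : Fin m → ℝ)
    (xstar : EuclideanSpace ℝ (Fin n))
    (hprimal : ∀ i, A.mulVec xstar i ≤ b i) :
    (∀ x : EuclideanSpace ℝ (Fin n), (∀ i, A.mulVec x i ≤ b i) → f xstar ≤ f x) ↔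
      ∃ μ : Fin m → ℝ, (∀ i, 0 ≤ μ i) ∧
        (∀ j, f' xstar j + A.transpose.mulVec μ j = 0) ∧
        (∀ i, μ i * (A.mulVec xstar i - b i) = 0) := by
  constructor
  · intro hmin
    let a : Fin m → EuclideanSpace ℝ (Fin n) →ₗ[ℝ] ℝ := fun i =>
      LinearMap.proj i ∘ₗ A.mulVecLin ∘ₗ (WithLp.linearEquiv 2 ℝ (Fin n → ℝ)).toLinearMap
    have ha : ∀ i x, a i x = A.mulVec x i := fun _ _ => rfl
    obtain ⟨w, hw, hsum⟩ := LinearMap.exists_nonneg_eq_sum_smul_of_forall_nonpos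
      {i | A.mulVec xstar i = b i} a (-(innerₛₗ ℝ (f' xstar))) (fun d hd => by
        have hlocal : IsLocalMinOn f
            {y : EuclideanSpace ℝ (Fin n) | ∀ i, A.mulVec y i ≤ b i} xstar :=
          IsMinOn.localize fun y hy => hmin y hy
        have := hlocal.hasFDerivWithinAt_nonneg
          (hgrad xstar).hasFDerivAt.hasFDerivWithinAt
          (A.mem_posTangentConeAt_of_active b hprimal fun i hi => hd i (by simpa using hi))
        simpa using this)
    refine ⟨fun i => if A.mulVec xstar i = b i then w i else 0, fun i => ?_, fun j => ?_,
      fun i => ?_⟩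
    · dsimp only
      split_ifs
      exacts [hw i, le_rfl]
    · have hj := LinearMap.congr_fun hsum (EuclideanSpace.single j 1)
      simp only [LinearMap.neg_apply, innerₛₗ_apply_apply, EuclideanSpace.inner_single_right,
        LinearMap.sum_apply, LinearMap.smul_apply, ha, smul_eq_mul,
        PiLp.ofLp_single, Matrix.mulVec_single_one, Matrix.col_apply, conj_trivial,
        one_mul] at hj
      rw [← neg_eq_iff_add_eq_zero, hj, Finset.sum_filter, Matrix.mulVec, dotProduct]
      refine Finset.sum_congr rfl fun i _ => ?_
      rw [Matrix.transpose_apply, mul_ite, mul_zero, mul_comm]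
    · dsimp only
      split_ifs with hi
      · rw [hi, sub_self, mul_zero]
      · rw [zero_mul]
  · rintro ⟨μ, hμ, hstat, hcompl⟩ x hx
    have hinner : inner ℝ (f' xstar) (x - xstar) =
        -∑ i, μ i * (A.mulVec x i - A.mulVec xstar i) := by
      have hgrad_eq : (f' xstar).ofLp = -A.transpose.mulVec μ :=
        funext fun j => eq_neg_of_add_eq_zero_left (hstat j)
      rw [EuclideanSpace.inner_eq_star_dotProduct, star_trivial, hgrad_eq, dotProduct_neg,
        dotProduct_comm, Matrix.mulVec_transpose, ← Matrix.dotProduct_mulVec, WithLp.ofLp_sub,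
        Matrix.mulVec_sub]
      rfl
    have hnonpos : ∑ i, μ i * (A.mulVec x i - A.mulVec xstar i) ≤ 0 :=
      Finset.sum_nonpos fun i _ => by
        linarith [hcompl i, mul_nonneg (hμ i) (sub_nonneg.2 (hx i))]
    have htangent := hconv.add_fderiv_le (Set.mem_univ xstar) (Set.mem_univ x)
      (hgrad xstar).hasFDerivAt
    rw [InnerProductSpace.toDual_apply_apply, hinner] at htangent
    linarith
end
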